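/- Define b_{λ,μ}(Q) := b_λ · b_μ · Ñ_{λ,μ}(Q)/Ñ_{μ,λ}(Q^{−1}) in ℚ(q1,q2,Q), with q = q2 and t = q1^{−1}. Then for all partitions λ, μ the following two recursions hold: for every addable cell c of λ, b_{λ∪{c},μ}(Q)/b_{λ,μ}(Q) = ((1−t)/(1−q)) · (ψ_λ(c)/ψ*_{λ∪{c}}(c)) · Ψ_μ(Q χ_c); and for every addable cell c of μ, b_{λ,μ∪{c}}(Q)/b_{λ,μ}(Q) = ((1−t)/(1−q)) · (ψ_μ(c)/ψ*_{μ∪{c}}(c)) · Ψ_λ(χ_c/Q)^{−1}. -/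

import Mathlib

open scoped BigOperators

noncomputable section

/-- The field `ℚ(q1, q2, Q)` of rational functions in three independent indeterminates. -/
abbrev K : Type := FractionRing (MvPolynomial (Fin 3) ℚ)

/-- The indeterminate `q1`. -/
def q1 : K := algebraMap (MvPolynomial (Fin 3) ℚ) K (MvPolynomial.X 0)

/-- The indeterminate `q2`. -/
def q2 : K := algebraMap (MvPolynomial (Fin 3) ℚ) K (MvPolynomial.X 1)

/-- The indeterminate `Q`. -/
def Qv : K := algebraMap (MvPolynomial (Fin 3) ℚ) K (MvPolynomial.X 2)

/-- `q3 = (q1 q2)⁻¹`. -/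
def q3 : K := (q1 * q2)⁻¹

/-- The Macdonald parameter `q = q2`. -/
def q : K := q2

/-- The Macdonald parameter `t = q1⁻¹`. -/
def t : K := q1⁻¹

/-- Box content `χ_c = q1^(i-1) * q2^(j-1)` of the 1-indexed cell `(i,j)`;
cells of a `YoungDiagram` are 0-indexed, `c = (i-1, j-1)`. -/
def chi (c : ℕ × ℕ) : K := q1 ^ c.1 * q2 ^ c.2

/-- `c` is an addable cell of the Young diagram `d`. -/
def IsAddable (d : YoungDiagram) (c : ℕ × ℕ) : Prop :=
  c ∉ d.cells ∧ IsLowerSet (↑(insert c d.cells) : Set (ℕ × ℕ))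

/-- `c` is a removable cell of the Young diagram `d`. -/
def IsRemovable (d : YoungDiagram) (c : ℕ × ℕ) : Prop :=
  c ∈ d.cells ∧ IsLowerSet (↑(d.cells.erase c) : Set (ℕ × ℕ))

open Classical in
/-- The (finite) set `A(d)` of addable cells of `d`. -/
noncomputable def addables (d : YoungDiagram) : Finset (ℕ × ℕ) :=
  (Finset.range (d.colLen 0 + 1) ×ˢ Finset.range (d.rowLen 0 + 1)).filter (IsAddable d)

open Classical in
/-- The (finite) set `R(d)` of removable cells of `d`. -/
noncomputable def removables (d : YoungDiagram) : Finset (ℕ × ℕ) :=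
  d.cells.filter (IsRemovable d)

/-- The Young diagram `λ ∪ {c}` obtained by adjoining an addable cell `c` to `λ`. -/
def addCell (d : YoungDiagram) (c : ℕ × ℕ)
    (h : IsLowerSet (↑(insert c d.cells) : Set (ℕ × ℕ))) : YoungDiagram :=
  ⟨insert c d.cells, h⟩

/-- The (K-theoretic) Nekrasov factor
`N_{λ,μ}(w) = ∏_{(i,j)∈λ} (1 − w q1^{λ^T_j − i + 1} q2^{j − μ_i})`
`           · ∏_{(i,j)∈μ} (1 − w q1^{i − μ^T_j} q2^{λ_i − j + 1})`
written in terms of 0-indexed cells (`λ^T_j = colLen (j-1)`, `λ_i = rowLen (i-1)`). -/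
def nek (lam mu : YoungDiagram) (w : K) : K :=
  (∏ c ∈ lam.cells,
      (1 - w * q1 ^ ((lam.colLen c.2 : ℤ) - (c.1 : ℤ)) *
        q2 ^ ((c.2 : ℤ) + 1 - (mu.rowLen c.1 : ℤ)))) *
    ∏ c ∈ mu.cells,
      (1 - w * q1 ^ ((c.1 : ℤ) + 1 - (mu.colLen c.2 : ℤ)) *
        q2 ^ ((lam.rowLen c.1 : ℤ) - (c.2 : ℤ)))

/-- The modified Nekrasov factor `Ñ_{λ,μ}(w) = N_{λ,μ}(w) · ∏_{c∈λ} (−q3⁻¹ w χ_c)⁻¹`. -/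
def nekT (lam mu : YoungDiagram) (w : K) : K :=
  nek lam mu w * (∏ c ∈ lam.cells, (-q3⁻¹ * w * chi c))⁻¹

/-- The Macdonald norm coefficient
`b_λ = ∏_{(i,j)∈λ} (1 − q^{λ_i−j} t^{λ^T_j−i+1})/(1 − q^{λ_i−j+1} t^{λ^T_j−i})`
(written in 0-indexed cells: for `c = (i-1, j-1)`, `λ_i − j = rowLen c.1 − c.2 − 1`,
`λ^T_j − i + 1 = colLen c.2 − c.1`). -/
def bcoef (d : YoungDiagram) : K :=
  ∏ c ∈ d.cells,
    (1 - q ^ ((d.rowLen c.1 : ℤ) - (c.2 : ℤ) - 1) * t ^ ((d.colLen c.2 : ℤ) - (c.1 : ℤ))) /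
      (1 - q ^ ((d.rowLen c.1 : ℤ) - (c.2 : ℤ)) * t ^ ((d.colLen c.2 : ℤ) - (c.1 : ℤ) - 1))

/-- The Pieri coefficient `ψ_λ(i,j)` (for the 1-indexed cell `(i,j) = (c.1+1, c.2+1)`):
`ψ_λ(i,j) = ∏_{i'=1}^{i−1} [(1 − q^{λ_{i'}−j+1} t^{i−i'−1})(1 − q^{λ_{i'}−j} t^{i−i'+1})]`
`            / [(1 − q^{λ_{i'}−j+1} t^{i−i'})(1 − q^{λ_{i'}−j} t^{i−i'})]`. -/
def psi (d : YoungDiagram) (c : ℕ × ℕ) : K :=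
  ∏ k ∈ Finset.range c.1,
    ((1 - q ^ ((d.rowLen k : ℤ) - (c.2 : ℤ)) * t ^ ((c.1 : ℤ) - (k : ℤ) - 1)) *
        (1 - q ^ ((d.rowLen k : ℤ) - (c.2 : ℤ) - 1) * t ^ ((c.1 : ℤ) - (k : ℤ) + 1))) /
      ((1 - q ^ ((d.rowLen k : ℤ) - (c.2 : ℤ)) * t ^ ((c.1 : ℤ) - (k : ℤ))) *
        (1 - q ^ ((d.rowLen k : ℤ) - (c.2 : ℤ) - 1) * t ^ ((c.1 : ℤ) - (k : ℤ))))

/-- The dual Pieri coefficient `ψ*_λ(i,j)` (for the 1-indexed cell `(i,j) = (c.1+1, c.2+1)`):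
`ψ*_λ(i,j) = ∏_{j'=1}^{j−1} [(1 − q^{j−j'−1} t^{λ^T_{j'}−i+1})(1 − q^{j−j'+1} t^{λ^T_{j'}−i})]`
`             / [(1 − q^{j−j'} t^{λ^T_{j'}−i+1})(1 − q^{j−j'} t^{λ^T_{j'}−i})]`. -/
def psiStar (d : YoungDiagram) (c : ℕ × ℕ) : K :=
  ∏ k ∈ Finset.range c.2,
    ((1 - q ^ ((c.2 : ℤ) - (k : ℤ) - 1) * t ^ ((d.colLen k : ℤ) - (c.1 : ℤ))) *
        (1 - q ^ ((c.2 : ℤ) - (k : ℤ) + 1) * t ^ ((d.colLen k : ℤ) - (c.1 : ℤ) - 1))) /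
      ((1 - q ^ ((c.2 : ℤ) - (k : ℤ)) * t ^ ((d.colLen k : ℤ) - (c.1 : ℤ))) *
        (1 - q ^ ((c.2 : ℤ) - (k : ℤ)) * t ^ ((d.colLen k : ℤ) - (c.1 : ℤ) - 1)))

/-- `Ψ_λ(w) = ∏_{c∈A(λ)} (1 − q3 χ_c/w)/(1 − χ_c/w) · ∏_{c∈R(λ)} (1 − χ_c/(q3 w))/(1 − χ_c/w)`. -/
def PsiF (d : YoungDiagram) (w : K) : K :=
  (∏ c ∈ addables d, ((1 - q3 * chi c / w) / (1 - chi c / w))) *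
    ∏ c ∈ removables d, ((1 - chi c / (q3 * w)) / (1 - chi c / w))

/-- `b_{λ,μ}(Q) = b_λ b_μ Ñ_{λ,μ}(Q)/Ñ_{μ,λ}(Q⁻¹)`. -/
def blm (lam mu : YoungDiagram) (w : K) : K :=
  bcoef lam * bcoef mu * nekT lam mu w / nekT mu lam w⁻¹

theorem q1_ne : q1 ≠ 0 := by
  simp [q1]

theorem q2_ne : q2 ≠ 0 := by
  simp [q2]

theorem Qv_ne : Qv ≠ 0 := by
  simp [Qv]

theorem mono_nat (a b c a' b' c' : ℕ)
    (h : q1 ^ a * q2 ^ b * Qv ^ c = q1 ^ a' * q2 ^ b' * Qv ^ c') :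
    a = a' ∧ b = b' ∧ c = c' := by
  unfold q1 q2 Qv at h
  simp only [← map_pow, ← map_mul] at h
  have h2 := IsFractionRing.injective (MvPolynomial (Fin 3) ℚ) K h
  simp only [MvPolynomial.X_pow_eq_monomial, MvPolynomial.monomial_mul, mul_one] at h2
  rw [MvPolynomial.monomial_left_inj one_ne_zero] at h2
  refine ⟨?_, ?_, ?_⟩
  · simpa using DFunLike.congr_fun h2 0
  · simpa using DFunLike.congr_fun h2 1
  · simpa using DFunLike.congr_fun h2 2

theorem zpow_split (x : K) (hx : x ≠ 0) (a : ℤ) :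
    x ^ a = x ^ a.toNat / x ^ (-a).toNat := by
  have : a = (a.toNat : ℤ) - ((-a).toNat : ℤ) := by omega
  conv_lhs => rw [this]
  rw [zpow_sub₀ hx, zpow_natCast, zpow_natCast]

theorem mono_int (a b c : ℤ) (h : q1 ^ a * q2 ^ b * Qv ^ c = 1) : a = 0 ∧ b = 0 ∧ c = 0 := by
  rw [zpow_split q1 q1_ne, zpow_split q2 q2_ne, zpow_split Qv Qv_ne] at h
  have h1 := pow_ne_zero (-a).toNat q1_ne
  have h2 := pow_ne_zero (-b).toNat q2_ne
  have h3 := pow_ne_zero (-c).toNat Qv_ne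
  have := mono_nat a.toNat b.toNat c.toNat (-a).toNat (-b).toNat (-c).toNat (by
    field_simp at h
    linear_combination h)
  omega

/-- basic factor -/
def EE (y : K) (a b : ℤ) : K := 1 - y * q1 ^ a * q2 ^ b

/-- generic -/
def Gen (y : K) : Prop := y ≠ 0 ∧ ∀ a b : ℤ, EE y a b ≠ 0

theorem gen_Qv : Gen Qv := by
  refine ⟨Qv_ne, fun a b h => ?_⟩
  have := mono_int a b 1 (by unfold EE at h; rw [zpow_one]; linear_combination -h)
  omega

theorem gen_Qv_inv : Gen Qv⁻¹ := by
  refine ⟨inv_ne_zero Qv_ne, fun a b h => ?_⟩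
  have := mono_int a b (-1) (by unfold EE at h; rw [zpow_neg_one]; linear_combination -h)
  omega

theorem EE_shift (y : K) (A B a b : ℤ) :
    EE (y * q1 ^ A * q2 ^ B) a b = EE y (A + a) (B + b) := by
  unfold EE
  rw [zpow_add₀ q1_ne, zpow_add₀ q2_ne]; ring

theorem EE_flip (w : K) (hw : w ≠ 0) (A B a b : ℤ) :
    EE w (A - a) (B - b) = -(w * q1 ^ (A - a) * q2 ^ (B - b)) *
      EE ((w * q1 ^ A * q2 ^ B)⁻¹) a b := by
  unfold EE
  have h1 := zpow_ne_zero A q1_ne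
  have h2 := zpow_ne_zero B q2_ne
  have h3 := zpow_ne_zero a q1_ne
  have h4 := zpow_ne_zero b q2_ne
  rw [zpow_sub₀ q1_ne, zpow_sub₀ q2_ne]
  field_simp
  ring

theorem gen_shift (y : K) (hy : Gen y) (A B : ℤ) : Gen (y * q1 ^ A * q2 ^ B) := by
  refine ⟨mul_ne_zero (mul_ne_zero hy.1 (zpow_ne_zero _ q1_ne)) (zpow_ne_zero _ q2_ne), ?_⟩
  intro a b
  rw [EE_shift]
  exact hy.2 _ _

theorem gen_inv (y : K) (hy : Gen y) : Gen y⁻¹ := by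
  refine ⟨inv_ne_zero hy.1, fun a b => ?_⟩
  have h := hy.2 (0 - a) (0 - b)
  rw [EE_flip y hy.1] at h
  simpa using right_ne_zero_of_mul h

theorem qt_ne (a b : ℤ) (h : a ≠ 0 ∨ b ≠ 0) : 1 - q ^ a * t ^ b ≠ 0 := by
  intro h0
  have := mono_int (-b) a 0 (by
    unfold q t at h0
    rw [inv_zpow', ] at h0
    rw [zpow_zero]
    linear_combination -h0)
  omega

/-! Young diagram facts -/

theorem mem_row (d : YoungDiagram) (a b : ℕ) : (a, b) ∈ d.cells ↔ b < d.rowLen a := by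
  rw [YoungDiagram.mem_cells]; exact YoungDiagram.mem_iff_lt_rowLen

theorem mem_col (d : YoungDiagram) (a b : ℕ) : (a, b) ∈ d.cells ↔ a < d.colLen b := by
  rw [YoungDiagram.mem_cells]; exact YoungDiagram.mem_iff_lt_colLen

theorem row_col (d : YoungDiagram) (a b : ℕ) : b < d.rowLen a ↔ a < d.colLen b := by
  rw [← mem_row, mem_col]

theorem addable_iff (d : YoungDiagram) (a b : ℕ) :
    IsAddable d (a, b) ↔ d.rowLen a = b ∧ (a = 0 ∨ d.rowLen a < d.rowLen (a - 1)) := by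
  constructor
  · rintro ⟨h1, h2⟩
    rw [mem_row] at h1
    have hr : d.rowLen a = b := by
      by_contra hne
      have : (a, b - 1) ∈ (↑(insert (a, b) d.cells) : Set (ℕ × ℕ)) :=
        h2 (a := (a, b)) (b := (a, b - 1)) (by simp [Prod.le_def]) (by simp)
      simp only [Finset.coe_insert, Set.mem_insert_iff, Finset.mem_coe, Prod.mk.injEq,
        mem_row] at this
      omega
    refine ⟨hr, ?_⟩
    by_contra hne
    push Not at hne
    have : (a - 1, b) ∈ (↑(insert (a, b) d.cells) : Set (ℕ × ℕ)) :=
      h2 (a := (a, b)) (b := (a - 1, b)) (by simp [Prod.le_def]) (by simp)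
    simp only [Finset.coe_insert, Set.mem_insert_iff, Finset.mem_coe, Prod.mk.injEq,
        mem_row] at this
    omega
  · rintro ⟨h1, h2⟩
    refine ⟨by rw [mem_row]; omega, ?_⟩
    rintro ⟨x1, x2⟩ ⟨y1, y2⟩ hle hx
    simp only [Finset.coe_insert, Set.mem_insert_iff, Finset.mem_coe, Prod.mk.injEq,
        mem_row, Prod.mk_le_mk] at hx hle ⊢
    rcases hx with hx | hx
    · by_cases hya : y1 = a
      · subst hya; omega
      · have := d.rowLen_anti _ _ (show y1 ≤ a - 1 by omega)
        omega
    · have := d.rowLen_anti _ _ hle.1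
      omega

theorem removable_iff (d : YoungDiagram) (a b : ℕ) :
    IsRemovable d (a, b) ↔ d.rowLen a = b + 1 ∧ d.rowLen (a + 1) < d.rowLen a := by
  constructor
  · rintro ⟨h1, h2⟩
    rw [mem_row] at h1
    constructor
    · by_contra hne
      have : (a, b) ∈ (↑(d.cells.erase (a, b)) : Set (ℕ × ℕ)) :=
        h2 (a := (a, b + 1)) (b := (a, b)) (by simp [Prod.le_def]) (by
          simp only [Finset.coe_erase, Set.mem_sdiff, Finset.mem_coe, mem_row]
          refine ⟨by omega, by simp⟩)
      simp at this
    · by_contra hne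
      have : (a, b) ∈ (↑(d.cells.erase (a, b)) : Set (ℕ × ℕ)) :=
        h2 (a := (a + 1, b)) (b := (a, b)) (by simp [Prod.le_def]) (by
          simp only [Finset.coe_erase, Set.mem_sdiff, Finset.mem_coe, mem_row]
          refine ⟨by omega, by simp⟩)
      simp at this
  · rintro ⟨h1, h2⟩
    refine ⟨by rw [mem_row]; omega, ?_⟩
    rintro ⟨x1, x2⟩ ⟨y1, y2⟩ hle hx
    simp only [Finset.coe_erase, Set.mem_sdiff, Finset.mem_coe, Set.mem_singleton_iff,
      Prod.mk.injEq, mem_row, Prod.mk_le_mk] at hx hle ⊢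
    have := d.rowLen_anti _ _ hle.1
    refine ⟨by omega, ?_⟩
    rintro ⟨rfl, rfl⟩
    by_cases hxa : x1 = y1
    · subst hxa; omega
    · have := d.rowLen_anti _ _ (show y1 + 1 ≤ x1 by omega)
      omega

/-- rows with corners -/
def SS (d : YoungDiagram) (n : ℕ) : Finset ℕ :=
  (Finset.range n).filter (fun k => d.rowLen (k + 1) < d.rowLen k)

theorem prod_addables (d : YoungDiagram) (n : ℕ) (hn : d.rowLen n = 0) (f : ℕ × ℕ → K) :
    ∏ c ∈ addables d, f c =
      f (0, d.rowLen 0) * ∏ k ∈ SS d n, f (k + 1, d.rowLen (k + 1)) := by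
  classical
  have : addables d = insert (0, d.rowLen 0)
      ((SS d n).image (fun k => (k + 1, d.rowLen (k + 1)))) := by
    ext ⟨a, b⟩
    simp only [addables, SS, Finset.mem_filter, addable_iff, Finset.mem_product, Finset.mem_range,
      Finset.mem_insert, Finset.mem_image, Prod.mk.injEq]
    constructor
    · rintro ⟨-, h1, h2⟩
      by_cases ha : a = 0
      · left; subst ha; omega
      · right
        obtain ⟨k, rfl⟩ : ∃ k, a = k + 1 := ⟨a - 1, by omega⟩
        simp only [Nat.add_sub_cancel] at h2
        refine ⟨k, ⟨?_, by omega⟩, rfl, h1⟩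
        by_contra hk
        have := d.rowLen_anti _ _ (show n ≤ k by omega)
        omega
    · rintro (⟨rfl, rfl⟩ | ⟨k, ⟨h1, h2⟩, rfl, rfl⟩)
      · simp
      · have h3 := d.rowLen_anti _ _ (show 0 ≤ k + 1 by omega)
        have h4 := (row_col d k 0).1 (by omega)
        refine ⟨⟨by omega, by omega⟩, rfl, Or.inr (by simpa using h2)⟩
  rw [this, Finset.prod_insert, Finset.prod_image]
  · intro x _ y _ h
    simp only [Prod.mk.injEq] at h
    omega
  · simp

theorem prod_removables (d : YoungDiagram) (n : ℕ) (hn : d.rowLen n = 0) (f : ℕ × ℕ → K) :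
    ∏ c ∈ removables d, f c = ∏ k ∈ SS d n, f (k, d.rowLen k - 1) := by
  classical
  have : removables d = (SS d n).image (fun k => (k, d.rowLen k - 1)) := by
    ext ⟨a, b⟩
    simp only [removables, SS, Finset.mem_filter, removable_iff, Finset.mem_range,
      Finset.mem_image, Prod.mk.injEq, mem_row]
    constructor
    · rintro ⟨h0, h1, h2⟩
      refine ⟨a, ⟨?_, h2⟩, rfl, by omega⟩
      by_contra hk
      have := d.rowLen_anti _ _ (show n ≤ a by omega)
      omega
    · rintro ⟨k, ⟨h1, h2⟩, rfl, rfl⟩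
      omega
  rw [this, Finset.prod_image]
  intro x _ y _ h
  simp only [Prod.mk.injEq] at h
  exact h.1

/-- the one-cell ratio -/
def GG (d : YoungDiagram) (i : ℕ) (y : K) : K :=
  EE y i (d.rowLen i) *
    (∏ k ∈ Finset.range i, EE y k (d.rowLen k) / EE y ((k : ℤ) + 1) (d.rowLen k)) *
    ∏ k ∈ Finset.range (d.rowLen i), EE y (d.colLen k) k / EE y (d.colLen k) ((k : ℤ) + 1)

theorem tele (f : ℕ → K) (hf : ∀ k, f k ≠ 0) (m n : ℕ) (h : m ≤ n) :
    ∏ k ∈ Finset.Ico m n, f k / f (k + 1) = f m / f n := by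
  induction n, h using Nat.le_induction with
  | base => simp [hf]
  | succ n hmn ih =>
    rw [Finset.prod_Ico_succ_top hmn, ih]
    have := hf n
    have := hf (n + 1)
    field_simp

theorem GG_succ (d : YoungDiagram) (i : ℕ) (y : K) (hy : Gen y) :
    GG d i y = GG d (i + 1) y := by
  unfold GG
  have hle : d.rowLen (i + 1) ≤ d.rowLen i := d.rowLen_anti _ _ (by omega)
  rw [← Finset.prod_range_mul_prod_Ico _ hle, Finset.prod_range_succ]
  have : ∏ k ∈ Finset.Ico (d.rowLen (i + 1)) (d.rowLen i),
      EE y (d.colLen k) k / EE y (d.colLen k) ((k : ℤ) + 1)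
      = EE y ((i : ℤ) + 1) (d.rowLen (i + 1)) / EE y ((i : ℤ) + 1) (d.rowLen i) := by
    rw [← tele (fun k => EE y ((i : ℤ) + 1) k) (fun k => hy.2 _ _) _ _ hle]
    refine Finset.prod_congr rfl fun k hk => ?_
    rw [Finset.mem_Ico] at hk
    have h1 := row_col d i k
    have h2 := row_col d (i + 1) k
    have : d.colLen k = i + 1 := by omega
    rw [this]
    push_cast
    rfl
  rw [this]
  push_cast
  have := hy.2 i (d.rowLen i)
  have := hy.2 ((i : ℤ) + 1) (d.rowLen i)
  have := hy.2 ((i : ℤ) + 1) (d.rowLen (i + 1))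
  field_simp

theorem GG_add (d : YoungDiagram) (i : ℕ) (y : K) (hy : Gen y) (m : ℕ) :
    GG d i y = GG d (i + m) y := by
  induction m with
  | zero => rfl
  | succ m ih => rw [ih, GG_succ d _ y hy]; rfl

theorem GG_zero (d : YoungDiagram) (n : ℕ) (y : K) (hy : Gen y) (hn : d.rowLen n = 0) :
    GG d n y = EE y 0 (d.rowLen 0) * ∏ k ∈ SS d n,
      EE y ((k : ℤ) + 1) (d.rowLen (k + 1)) / EE y ((k : ℤ) + 1) (d.rowLen k) := by
  have key : ∀ m : ℕ, EE y m (d.rowLen m) *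
      (∏ k ∈ Finset.range m, EE y k (d.rowLen k) / EE y ((k : ℤ) + 1) (d.rowLen k)) =
      EE y 0 (d.rowLen 0) * ∏ k ∈ Finset.range m,
      EE y ((k : ℤ) + 1) (d.rowLen (k + 1)) / EE y ((k : ℤ) + 1) (d.rowLen k) := by
    intro m
    induction m with
    | zero => simp
    | succ m ih =>
      rw [Finset.prod_range_succ, Finset.prod_range_succ, ← mul_assoc (EE y 0 _), ← ih]
      push_cast
      ring
  unfold GG
  rw [key, hn, Finset.range_zero, Finset.prod_empty, mul_one]
  congr 1
  unfold SS
  rw [Finset.prod_filter]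
  refine Finset.prod_congr rfl fun k _ => ?_
  split_ifs with h
  · rfl
  · have : d.rowLen (k + 1) = d.rowLen k := by
      have := d.rowLen_anti _ _ (show k ≤ k + 1 by omega)
      omega
    rw [this, div_self (hy.2 _ _)]

theorem GG_ne (d : YoungDiagram) (n : ℕ) (y : K) (hy : Gen y) : GG d n y ≠ 0 := by
  unfold GG
  refine mul_ne_zero (mul_ne_zero (hy.2 _ _) ?_) ?_ <;>
  exact Finset.prod_ne_zero_iff.2 fun k _ => div_ne_zero (hy.2 _ _) (hy.2 _ _)

theorem q3_mul (x : K) : q3 * x = x * q1 ^ (-1 : ℤ) * q2 ^ (-1 : ℤ) := by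
  unfold q3
  rw [zpow_neg_one, zpow_neg_one, mul_inv]; ring

theorem PsiF_eq (d : YoungDiagram) (i : ℕ) (x : K) (hx : Gen x) :
    PsiF d x = GG d i (q3 * x⁻¹) / GG d i x⁻¹ := by
  have hy := gen_inv x hx
  have hy3 : Gen (q3 * x⁻¹) := by rw [q3_mul]; exact gen_shift _ hy _ _
  obtain ⟨n, hn, hin⟩ : ∃ n, d.rowLen n = 0 ∧ i ≤ n := by
    refine ⟨d.colLen 0 + i, ?_, by omega⟩
    have := row_col d (d.colLen 0 + i) 0
    omega
  obtain ⟨m, rfl⟩ := Nat.exists_eq_add_of_le hin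
  rw [GG_add d i _ hy m, GG_add d i _ hy3 m, GG_zero d _ _ hy hn, GG_zero d _ _ hy3 hn]
  unfold PsiF
  rw [prod_addables d _ hn, prod_removables d _ hn, mul_assoc, ← Finset.prod_mul_distrib,
    mul_div_mul_comm, ← Finset.prod_div_distrib]
  have hA : ∀ (a b : ℕ) (z : K), 1 - chi (a, b) * z = EE z a b := by
    intro a b z
    simp only [EE, chi, zpow_natCast]; ring
  have e1 : ∀ a b : ℕ, 1 - q3 * chi (a, b) / x = EE (q3 * x⁻¹) a b := by
    intro a b; rw [← hA]; ring
  have e2 : ∀ a b : ℕ, 1 - chi (a, b) / x = EE x⁻¹ a b := by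
    intro a b; rw [← hA]; ring
  congr 1
  · rw [e1, e2]; simp
  · refine Finset.prod_congr rfl fun k hk => ?_
    simp only [SS, Finset.mem_filter] at hk
    obtain ⟨r, hr⟩ : ∃ r, d.rowLen k = r + 1 := ⟨d.rowLen k - 1, by omega⟩
    have e3 : 1 - chi (k, r) / (q3 * x) = EE x⁻¹ ((k : ℤ) + 1) ((r : ℤ) + 1) := by
      have := q1_ne
      have := q2_ne
      have := hx.1
      unfold EE chi q3
      rw [zpow_add₀ q1_ne, zpow_add₀ q2_ne]
      simp only [zpow_natCast, zpow_one]
      field_simp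
    have e4 : EE (q3 * x⁻¹) ((k : ℤ) + 1) ((r : ℤ) + 1) = EE x⁻¹ k r := by
      rw [q3_mul, EE_shift]; congr 1 <;> ring
    rw [hr]
    simp only [Nat.add_sub_cancel]
    rw [e1, e2, e2, e3]
    push_cast
    rw [e4]
    have := hy.2 k r
    have := hy.2 ((k : ℤ) + 1) ((r : ℤ) + 1)
    have := hy.2 ((k : ℤ) + 1) (d.rowLen (k + 1))
    field_simp

/-! products over cells -/

theorem prod_row (d : YoungDiagram) (i : ℕ) (f g : ℕ × ℕ → K) (hg : ∀ x ∈ d.cells, g x ≠ 0)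
    (hfg : ∀ x ∈ d.cells, x.1 ≠ i → f x = g x) :
    ∏ x ∈ d.cells, f x = (∏ x ∈ d.cells, g x) *
      ∏ k ∈ Finset.range (d.rowLen i), f (i, k) / g (i, k) := by
  have h : ∏ x ∈ d.cells, f x / g x = ∏ k ∈ Finset.range (d.rowLen i), f (i, k) / g (i, k) := by
    rw [← Finset.prod_subset (s₁ := (Finset.range (d.rowLen i)).image (fun k => (i, k)))]
    · rw [Finset.prod_image]
      intro x _ y _ h
      simpa using h
    · intro x hx
      simp only [Finset.mem_image, Finset.mem_range] at hx
      obtain ⟨k, hk, rfl⟩ := hx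
      exact (mem_row _ _ _).2 hk
    · rintro ⟨a, b⟩ hx hx2
      have : a ≠ i := by
        rintro rfl
        exact hx2 (Finset.mem_image.2 ⟨b, Finset.mem_range.2 ((mem_row _ _ _).1 hx), rfl⟩)
      rw [hfg _ hx this, div_self (hg _ hx)]
  rw [← h, Finset.prod_div_distrib, mul_div_cancel₀]
  exact Finset.prod_ne_zero_iff.2 hg

theorem prod_col (d : YoungDiagram) (j : ℕ) (f g : ℕ × ℕ → K) (hg : ∀ x ∈ d.cells, g x ≠ 0)
    (hfg : ∀ x ∈ d.cells, x.2 ≠ j → f x = g x) :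
    ∏ x ∈ d.cells, f x = (∏ x ∈ d.cells, g x) *
      ∏ k ∈ Finset.range (d.colLen j), f (k, j) / g (k, j) := by
  have h : ∏ x ∈ d.cells, f x / g x = ∏ k ∈ Finset.range (d.colLen j), f (k, j) / g (k, j) := by
    rw [← Finset.prod_subset (s₁ := (Finset.range (d.colLen j)).image (fun k => (k, j)))]
    · rw [Finset.prod_image]
      intro x _ y _ h
      simpa using h
    · intro x hx
      simp only [Finset.mem_image, Finset.mem_range] at hx
      obtain ⟨k, hk, rfl⟩ := hx
      exact (mem_col _ _ _).2 hk
    · rintro ⟨a, b⟩ hx hx2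
      have : b ≠ j := by
        rintro rfl
        exact hx2 (Finset.mem_image.2 ⟨a, Finset.mem_range.2 ((mem_col _ _ _).1 hx), rfl⟩)
      rw [hfg _ hx this, div_self (hg _ hx)]
  rw [← h, Finset.prod_div_distrib, mul_div_cancel₀]
  exact Finset.prod_ne_zero_iff.2 hg

theorem addable_row (d : YoungDiagram) (i j : ℕ) (h : IsAddable d (i, j)) : d.rowLen i = j :=
  ((addable_iff _ _ _).1 h).1

theorem addable_col (d : YoungDiagram) (i j : ℕ) (h : IsAddable d (i, j)) : d.colLen j = i := by
  have h0 := (addable_iff _ _ _).1 h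
  have h1 := row_col d i j
  have h2 := row_col d (i - 1) j
  omega

theorem mem_addCell (d : YoungDiagram) (c : ℕ × ℕ) (h) (x : ℕ × ℕ) :
    x ∈ (addCell d c h).cells ↔ x = c ∨ x ∈ d.cells := by
  simp [addCell]

theorem rowLen_add (d : YoungDiagram) (i j : ℕ) (h : IsAddable d (i, j)) (k : ℕ) :
    (addCell d (i, j) h.2).rowLen k = if k = i then j + 1 else d.rowLen k := by
  have hr := addable_row d i j h
  have key : ∀ b, b < (addCell d (i, j) h.2).rowLen k ↔ (k = i ∧ b = j) ∨ b < d.rowLen k := by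
    intro b
    rw [← mem_row, ← mem_row, mem_addCell, Prod.mk.injEq]
  split_ifs with hk
  · subst hk
    have h1 := key j
    have h2 := key (j + 1)
    omega
  · have h1 := key (d.rowLen k)
    have h2 := key ((addCell d (i, j) h.2).rowLen k)
    omega

theorem colLen_add (d : YoungDiagram) (i j : ℕ) (h : IsAddable d (i, j)) (k : ℕ) :
    (addCell d (i, j) h.2).colLen k = if k = j then i + 1 else d.colLen k := by
  have hr := addable_col d i j h
  have key : ∀ b, b < (addCell d (i, j) h.2).colLen k ↔ (b = i ∧ k = j) ∨ b < d.colLen k := by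
    intro b
    rw [← mem_col, ← mem_col, mem_addCell, Prod.mk.injEq]
  split_ifs with hk
  · subst hk
    have h1 := key i
    have h2 := key (i + 1)
    omega
  · have h1 := key (d.colLen k)
    have h2 := key ((addCell d (i, j) h.2).colLen k)
    omega

theorem prod_addCell (d : YoungDiagram) (c : ℕ × ℕ) (h : IsAddable d c) (f : ℕ × ℕ → K) :
    ∏ x ∈ (addCell d c h.2).cells, f x = f c * ∏ x ∈ d.cells, f x := by
  show ∏ x ∈ insert c d.cells, f x = _
  exact Finset.prod_insert h.1

theorem nek_ne (l m : YoungDiagram) (w : K) (hw : Gen w) : nek l m w ≠ 0 := by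
  unfold nek
  exact mul_ne_zero (Finset.prod_ne_zero_iff.2 fun _ _ => hw.2 _ _)
    (Finset.prod_ne_zero_iff.2 fun _ _ => hw.2 _ _)

theorem chi_ne (c : ℕ × ℕ) : chi c ≠ 0 :=
  mul_ne_zero (pow_ne_zero _ q1_ne) (pow_ne_zero _ q2_ne)

theorem q3_ne : q3 ≠ 0 := inv_ne_zero (mul_ne_zero q1_ne q2_ne)

theorem nekT_ne (l m : YoungDiagram) (w : K) (hw : Gen w) : nekT l m w ≠ 0 := by
  unfold nekT
  refine mul_ne_zero (nek_ne l m w hw) (inv_ne_zero (Finset.prod_ne_zero_iff.2 fun _ _ => ?_))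
  exact mul_ne_zero (mul_ne_zero (neg_ne_zero.2 (inv_ne_zero q3_ne)) hw.1) (chi_ne _)

theorem nek_eq (l m : YoungDiagram) (w : K) : nek l m w =
    (∏ c ∈ l.cells, EE w ((l.colLen c.2 : ℤ) - (c.1 : ℤ)) ((c.2 : ℤ) + 1 - (m.rowLen c.1 : ℤ))) *
    ∏ c ∈ m.cells, EE w ((c.1 : ℤ) + 1 - (m.colLen c.2 : ℤ))
      ((l.rowLen c.1 : ℤ) - (c.2 : ℤ)) := rfl

theorem nek_right (l m : YoungDiagram) (i j : ℕ) (h : IsAddable l (i, j)) (v : K) (hv : Gen v) :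
    nek m (addCell l (i, j) h.2) v = nek m l v * GG m i (v * q1 ^ (-(i : ℤ)) * q2 ^ (-(j : ℤ))) := by
  have hr := addable_row l i j h
  have hc := addable_col l i j h
  rw [nek_eq, nek_eq, prod_addCell l _ h]
  rw [prod_row m i _ (fun c => EE v ((m.colLen c.2 : ℤ) - (c.1 : ℤ))
    ((c.2 : ℤ) + 1 - (l.rowLen c.1 : ℤ))) (fun _ _ => hv.2 _ _)]
  swap
  · intro x _ hx
    simp only [rowLen_add l i j h, if_neg hx]
  rw [prod_col l j _ (fun c => EE v ((c.1 : ℤ) + 1 - (l.colLen c.2 : ℤ))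
      ((m.rowLen c.1 : ℤ) - (c.2 : ℤ))) (fun _ _ => hv.2 _ _)]
  swap
  · intro x _ hx
    simp only [colLen_add l i j h, if_neg hx]
  unfold GG
  simp only [rowLen_add l i j h, colLen_add l i j h, if_true, hr, hc, EE_shift]
  have e1 : ∀ k : ℕ, EE v ((m.colLen k : ℤ) - i) ((k : ℤ) + 1 - ((j + 1 : ℕ) : ℤ)) /
      EE v ((m.colLen k : ℤ) - i) ((k : ℤ) + 1 - (j : ℤ)) =
      EE v (-(i : ℤ) + m.colLen k) (-(j : ℤ) + k) /
      EE v (-(i : ℤ) + m.colLen k) (-(j : ℤ) + ((k : ℤ) + 1)) := by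
    intro k
    congr 2 <;> push_cast <;> ring
  have e2 : ∀ k : ℕ, EE v ((k : ℤ) + 1 - ((i + 1 : ℕ) : ℤ)) ((m.rowLen k : ℤ) - j) /
      EE v ((k : ℤ) + 1 - (i : ℤ)) ((m.rowLen k : ℤ) - j) =
      EE v (-(i : ℤ) + k) (-(j : ℤ) + m.rowLen k) /
      EE v (-(i : ℤ) + ((k : ℤ) + 1)) (-(j : ℤ) + m.rowLen k) := by
    intro k
    congr 2 <;> push_cast <;> ring
  have e3 : EE v ((i : ℤ) + 1 - ((i + 1 : ℕ) : ℤ)) ((m.rowLen i : ℤ) - j) =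
      EE v (-(i : ℤ) + i) (-(j : ℤ) + m.rowLen i) := by
    congr 1 <;> push_cast <;> ring
  simp only [e1, e2, e3]
  ring

theorem flip1 (w : K) (hw : w ≠ 0) (A B a b : ℤ) :
    EE w (A - a) (B - b) / EE w (A - (a + 1)) (B - b) =
    q1 * (EE ((w * q1 ^ A * q2 ^ B)⁻¹) a b / EE ((w * q1 ^ A * q2 ^ B)⁻¹) (a + 1) b) := by
  rw [EE_flip w hw, EE_flip w hw, mul_div_mul_comm]
  congr 1
  have h1 := zpow_ne_zero (A - (a + 1)) q1_ne
  have h2 := zpow_ne_zero (B - b) q2_ne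
  rw [show A - a = (A - (a + 1)) + 1 by ring, zpow_add_one₀ q1_ne]
  field_simp

theorem flip2 (w : K) (hw : w ≠ 0) (A B a b : ℤ) :
    EE w (A - a) (B - b) / EE w (A - a) (B - (b + 1)) =
    q2 * (EE ((w * q1 ^ A * q2 ^ B)⁻¹) a b / EE ((w * q1 ^ A * q2 ^ B)⁻¹) a (b + 1)) := by
  rw [EE_flip w hw, EE_flip w hw, mul_div_mul_comm]
  congr 1
  have h1 := zpow_ne_zero (A - a) q1_ne
  have h2 := zpow_ne_zero (B - (b + 1)) q2_ne
  rw [show B - b = (B - (b + 1)) + 1 by ring, zpow_add_one₀ q2_ne]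
  field_simp

theorem nek_left (l m : YoungDiagram) (i j : ℕ) (h : IsAddable l (i, j)) (w : K) (hw : Gen w) :
    nek (addCell l (i, j) h.2) m w = nek l m w * (-q3⁻¹ * w * chi (i, j)) *
      GG m i ((w * q1 ^ ((i : ℤ) + 1) * q2 ^ ((j : ℤ) + 1))⁻¹) := by
  have hr := addable_row l i j h
  have hc := addable_col l i j h
  rw [nek_eq, nek_eq, prod_addCell l _ h]
  rw [prod_row m i _ (fun c => EE w ((c.1 : ℤ) + 1 - (m.colLen c.2 : ℤ))
      ((l.rowLen c.1 : ℤ) - (c.2 : ℤ))) (fun _ _ => hw.2 _ _)]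
  swap
  · intro x _ hx
    simp only [rowLen_add l i j h, if_neg hx]
  rw [prod_col l j _ (fun c => EE w ((l.colLen c.2 : ℤ) - (c.1 : ℤ))
    ((c.2 : ℤ) + 1 - (m.rowLen c.1 : ℤ))) (fun _ _ => hw.2 _ _)]
  swap
  · intro x _ hx
    simp only [colLen_add l i j h, if_neg hx]
  unfold GG
  simp only [rowLen_add l i j h, colLen_add l i j h, if_true, hr, hc]
  have e1 : ∀ k : ℕ, EE w ((i : ℤ) + 1 - m.colLen k) (((j + 1 : ℕ) : ℤ) - k) /
      EE w ((i : ℤ) + 1 - m.colLen k) ((j : ℤ) - k) =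
      q2 * (EE ((w * q1 ^ ((i : ℤ) + 1) * q2 ^ ((j : ℤ) + 1))⁻¹) (m.colLen k) k /
      EE ((w * q1 ^ ((i : ℤ) + 1) * q2 ^ ((j : ℤ) + 1))⁻¹) (m.colLen k) ((k : ℤ) + 1)) := by
    intro k
    rw [← flip2 w hw.1]
    congr 2 <;> push_cast <;> ring
  have e2 : ∀ k : ℕ, EE w (((i + 1 : ℕ) : ℤ) - k) ((j : ℤ) + 1 - m.rowLen k) /
      EE w ((i : ℤ) - k) ((j : ℤ) + 1 - m.rowLen k) =
      q1 * (EE ((w * q1 ^ ((i : ℤ) + 1) * q2 ^ ((j : ℤ) + 1))⁻¹) k (m.rowLen k) /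
      EE ((w * q1 ^ ((i : ℤ) + 1) * q2 ^ ((j : ℤ) + 1))⁻¹) ((k : ℤ) + 1) (m.rowLen k)) := by
    intro k
    rw [← flip1 w hw.1]
    congr 2 <;> push_cast <;> ring
  have e3 : EE w (((i + 1 : ℕ) : ℤ) - i) ((j : ℤ) + 1 - m.rowLen i) * q1 ^ i * q2 ^ (m.rowLen i) =
      (-q3⁻¹ * w * chi (i, j)) *
      EE ((w * q1 ^ ((i : ℤ) + 1) * q2 ^ ((j : ℤ) + 1))⁻¹) i (m.rowLen i) := by
    push_cast
    rw [EE_flip w hw.1, zpow_sub₀ q1_ne, zpow_sub₀ q2_ne, zpow_add_one₀ q1_ne, zpow_add_one₀ q2_ne]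
    simp only [zpow_natCast, q3, chi, inv_inv]
    have := pow_ne_zero i q1_ne
    have := pow_ne_zero (m.rowLen i) q2_ne
    field_simp
  simp only [e1, e2, Finset.prod_mul_distrib, Finset.prod_const, Finset.card_range]
  linear_combination (∏ c ∈ l.cells, EE w ((l.colLen c.2 : ℤ) - (c.1 : ℤ)) ((c.2 : ℤ) + 1 - (m.rowLen c.1 : ℤ))) *
    (∏ c ∈ m.cells, EE w ((c.1 : ℤ) + 1 - (m.colLen c.2 : ℤ)) ((l.rowLen c.1 : ℤ) - (c.2 : ℤ))) *
    (∏ k ∈ Finset.range i, (EE ((w * q1 ^ ((i : ℤ) + 1) * q2 ^ ((j : ℤ) + 1))⁻¹) k (m.rowLen k) /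
      EE ((w * q1 ^ ((i : ℤ) + 1) * q2 ^ ((j : ℤ) + 1))⁻¹) ((k : ℤ) + 1) (m.rowLen k))) *
    (∏ k ∈ Finset.range (m.rowLen i), (EE ((w * q1 ^ ((i : ℤ) + 1) * q2 ^ ((j : ℤ) + 1))⁻¹) (m.colLen k) k /
      EE ((w * q1 ^ ((i : ℤ) + 1) * q2 ^ ((j : ℤ) + 1))⁻¹) (m.colLen k) ((k : ℤ) + 1))) * e3

theorem nekT_ratio (l m : YoungDiagram) (c : ℕ × ℕ) (h : IsAddable l c) (w : K) (hw : Gen w) :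
    nekT (addCell l c h.2) m w * nekT m l w⁻¹ =
      nekT l m w * nekT m (addCell l c h.2) w⁻¹ * PsiF m (w * chi c) := by
  obtain ⟨i, j⟩ := c
  have hchi : w * chi (i, j) = w * q1 ^ (i : ℤ) * q2 ^ (j : ℤ) := by
    simp only [chi, zpow_natCast]; ring
  have hx : Gen (w * chi (i, j)) := by rw [hchi]; exact gen_shift _ hw _ _
  have hG := GG_ne m i _ (gen_inv _ hx)
  rw [PsiF_eq m i _ hx]
  unfold nekT
  rw [prod_addCell l _ h, nek_left l m i j h w hw, nek_right l m i j h w⁻¹ (gen_inv _ hw)]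
  have e1 : (w * q1 ^ ((i : ℤ) + 1) * q2 ^ ((j : ℤ) + 1))⁻¹ = q3 * (w * chi (i, j))⁻¹ := by
    rw [hchi, zpow_add_one₀ q1_ne, zpow_add_one₀ q2_ne]
    simp only [q3, mul_inv]; ring
  have e2 : w⁻¹ * q1 ^ (-(i : ℤ)) * q2 ^ (-(j : ℤ)) = (w * chi (i, j))⁻¹ := by
    rw [hchi, zpow_neg, zpow_neg, mul_inv, mul_inv]
  rw [e1, e2]
  have h3 : -q3⁻¹ * w * chi (i, j) ≠ 0 :=
    mul_ne_zero (mul_ne_zero (neg_ne_zero.2 (inv_ne_zero q3_ne)) hw.1) (chi_ne _)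
  have gen_alg : ∀ N Z G2 P1 M P2 G1 : K, Z ≠ 0 → G1 ≠ 0 →
      N * Z * G2 * (Z * P1)⁻¹ * (M * P2⁻¹) = N * P1⁻¹ * (M * G1 * P2⁻¹) * (G2 / G1) := by
    intro N Z G2 P1 M P2 G1 hZ hG1
    field_simp
  exact gen_alg _ _ _ _ _ _ _ h3 hG

/-! b coefficients -/

theorem bfac_ne (d : YoungDiagram) (x : ℕ × ℕ) (hx : x ∈ d.cells) :
    (1 - q ^ ((d.rowLen x.1 : ℤ) - (x.2 : ℤ) - 1) * t ^ ((d.colLen x.2 : ℤ) - (x.1 : ℤ))) /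
      (1 - q ^ ((d.rowLen x.1 : ℤ) - (x.2 : ℤ)) * t ^ ((d.colLen x.2 : ℤ) - (x.1 : ℤ) - 1)) ≠ 0 := by
  have h1 := (mem_row d x.1 x.2).1 hx
  have h2 := (mem_col d x.1 x.2).1 hx
  exact div_ne_zero (qt_ne _ _ (by omega)) (qt_ne _ _ (by omega))

theorem bcoef_ne (d : YoungDiagram) : bcoef d ≠ 0 :=
  Finset.prod_ne_zero_iff.2 fun x hx => bfac_ne d x hx

theorem bcoef_add (d : YoungDiagram) (c : ℕ × ℕ) (h : IsAddable d c) :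
    bcoef (addCell d c h.2) = bcoef d *
      (((1 - t) / (1 - q)) * (psi d c / psiStar (addCell d c h.2) c)) := by
  obtain ⟨i, j⟩ := c
  have hr := addable_row d i j h
  have hc := addable_col d i j h
  unfold bcoef
  rw [prod_addCell d _ h]
  rw [prod_row d i _ (fun x => if x.1 = i then
    (1 - q ^ ((d.rowLen x.1 : ℤ) - (x.2 : ℤ) - 1) * t ^ ((d.colLen x.2 : ℤ) - (x.1 : ℤ))) /
      (1 - q ^ ((d.rowLen x.1 : ℤ) - (x.2 : ℤ)) * t ^ ((d.colLen x.2 : ℤ) - (x.1 : ℤ) - 1))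
    else (1 - q ^ ((d.rowLen x.1 : ℤ) - (x.2 : ℤ) - 1) *
        t ^ (((addCell d (i, j) h.2).colLen x.2 : ℤ) - (x.1 : ℤ))) /
      (1 - q ^ ((d.rowLen x.1 : ℤ) - (x.2 : ℤ)) *
        t ^ (((addCell d (i, j) h.2).colLen x.2 : ℤ) - (x.1 : ℤ) - 1)))]
  rotate_left
  · intro x hx
    have h1 := (mem_row d x.1 x.2).1 hx
    have h2 := (mem_col d x.1 x.2).1 hx
    have h3 := colLen_add d i j h x.2
    split_ifs at h3 ⊢ with h4 h5
    all_goals try exact bfac_ne d x hx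
    all_goals
      subst_vars
      exact div_ne_zero (qt_ne _ _ (by omega)) (qt_ne _ _ (by omega))
  · intro x hx hxi
    simp only [if_neg hxi, rowLen_add d i j h]
  rw [prod_col d j _ (fun x => 
    (1 - q ^ ((d.rowLen x.1 : ℤ) - (x.2 : ℤ) - 1) * t ^ ((d.colLen x.2 : ℤ) - (x.1 : ℤ))) /
      (1 - q ^ ((d.rowLen x.1 : ℤ) - (x.2 : ℤ)) * t ^ ((d.colLen x.2 : ℤ) - (x.1 : ℤ) - 1)))
    (fun x hx => bfac_ne d x hx)]
  swap
  · intro x hx hxj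
    simp only [colLen_add d i j h, if_neg hxj, ite_self]
  have e0 : ∀ A B C : K, A * (B * C) = B * (A * C) := fun A B C => by ring
  rw [hr, hc, mul_comm (_ / _), mul_assoc, mul_assoc]
  congr 1
  have f1 : (∏ k ∈ Finset.range i, (if ((k, j) : ℕ × ℕ).1 = i then
    (1 - q ^ ((d.rowLen k : ℤ) - (j : ℤ) - 1) * t ^ ((d.colLen j : ℤ) - (k : ℤ))) /
      (1 - q ^ ((d.rowLen k : ℤ) - (j : ℤ)) * t ^ ((d.colLen j : ℤ) - (k : ℤ) - 1))
    else (1 - q ^ ((d.rowLen k : ℤ) - (j : ℤ) - 1) *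
        t ^ (((addCell d (i, j) h.2).colLen j : ℤ) - (k : ℤ))) /
      (1 - q ^ ((d.rowLen k : ℤ) - (j : ℤ)) *
        t ^ (((addCell d (i, j) h.2).colLen j : ℤ) - (k : ℤ) - 1))) /
      ((1 - q ^ ((d.rowLen k : ℤ) - (j : ℤ) - 1) * t ^ ((d.colLen j : ℤ) - (k : ℤ))) /
      (1 - q ^ ((d.rowLen k : ℤ) - (j : ℤ)) * t ^ ((d.colLen j : ℤ) - (k : ℤ) - 1)))) =
      psi d (i, j) := by
    unfold psi
    refine Finset.prod_congr rfl fun k hk => ?_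
    have hk' := Finset.mem_range.1 hk
    simp only at hk'
    simp only [if_neg hk'.ne, colLen_add d i j h, if_true, hc]
    rw [div_div_div_eq]
    rw [show ((i + 1 : ℕ) : ℤ) - k = i - k + 1 by push_cast; ring, add_sub_cancel_right]
    congr 1
    ring
  have f2 : (∏ k ∈ Finset.range j,
      ((1 - q ^ (((addCell d (i, j) h.2).rowLen i : ℤ) - (k : ℤ) - 1) *
        t ^ (((addCell d (i, j) h.2).colLen k : ℤ) - (i : ℤ))) /
      (1 - q ^ (((addCell d (i, j) h.2).rowLen i : ℤ) - (k : ℤ)) *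
        t ^ (((addCell d (i, j) h.2).colLen k : ℤ) - (i : ℤ) - 1))) /
      ((1 - q ^ ((j : ℤ) - (k : ℤ) - 1) * t ^ ((d.colLen k : ℤ) - (i : ℤ))) /
      (1 - q ^ ((j : ℤ) - (k : ℤ)) * t ^ ((d.colLen k : ℤ) - (i : ℤ) - 1)))) =
      (psiStar (addCell d (i, j) h.2) (i, j))⁻¹ := by
    unfold psiStar
    rw [← Finset.prod_inv_distrib]
    refine Finset.prod_congr rfl fun k hk => ?_
    have hk' := Finset.mem_range.1 hk
    simp only at hk'
    simp only [if_neg hk'.ne, colLen_add d i j h, rowLen_add d i j h, if_true]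
    rw [div_div_div_eq, inv_div]
    rw [show ((j + 1 : ℕ) : ℤ) - k = j - k + 1 by push_cast; ring, add_sub_cancel_right]
    congr 1
    ring
  have f3 : (1 - q ^ (((addCell d (i, j) h.2).rowLen i : ℤ) - (j : ℤ) - 1) *
        t ^ (((addCell d (i, j) h.2).colLen j : ℤ) - (i : ℤ))) /
      (1 - q ^ (((addCell d (i, j) h.2).rowLen i : ℤ) - (j : ℤ)) *
        t ^ (((addCell d (i, j) h.2).colLen j : ℤ) - (i : ℤ) - 1)) = (1 - t) / (1 - q) := by
    simp [colLen_add d i j h, rowLen_add d i j h]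
  simp only [hr, hc, if_true] at f1 f2 f3 ⊢
  rw [f1, f2, f3]
  ring

/-- The two recursions satisfied by `b_{λ,μ}(Q)` (with `q = q2`, `t = q1⁻¹`):
for every addable cell `c` of `λ`,
`b_{λ∪{c},μ}(Q)/b_{λ,μ}(Q) = ((1−t)/(1−q))·(ψ_λ(c)/ψ*_{λ∪{c}}(c))·Ψ_μ(Q χ_c)`,
and for every addable cell `c` of `μ`,
`b_{λ,μ∪{c}}(Q)/b_{λ,μ}(Q) = ((1−t)/(1−q))·(ψ_μ(c)/ψ*_{μ∪{c}}(c))·Ψ_λ(χ_c/Q)⁻¹`. -/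
theorem stmt12 (lam mu : YoungDiagram) :
    (∀ c : ℕ × ℕ, ∀ h : IsAddable lam c,
        blm (addCell lam c h.2) mu Qv / blm lam mu Qv
          = ((1 - t) / (1 - q)) * (psi lam c / psiStar (addCell lam c h.2) c) *
              PsiF mu (Qv * chi c)) ∧
      ∀ c : ℕ × ℕ, ∀ h : IsAddable mu c,
        blm lam (addCell mu c h.2) Qv / blm lam mu Qv
          = ((1 - t) / (1 - q)) * (psi mu c / psiStar (addCell mu c h.2) c) *
              (PsiF lam (chi c / Qv))⁻¹ := by
  have hQ := gen_Qv
  have hQi := gen_Qv_inv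
  have hl := bcoef_ne lam
  have hm := bcoef_ne mu
  constructor
  · intro c h
    have key := nekT_ratio lam mu c h Qv hQ
    unfold blm
    rw [bcoef_add lam c h]
    have n1 := nekT_ne lam mu _ hQ
    have n2 := nekT_ne mu lam _ hQi
    have n3 := nekT_ne mu (addCell lam c h.2) _ hQi
    have key2 : nekT (addCell lam c h.2) mu Qv = nekT lam mu Qv *
        nekT mu (addCell lam c h.2) Qv⁻¹ * PsiF mu (Qv * chi c) / nekT mu lam Qv⁻¹ := by
      rw [← key, mul_div_cancel_right₀ _ n2]
    rw [key2]
    generalize nekT mu lam Qv⁻¹ = X1 at n2 ⊢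
    generalize nekT mu (addCell lam c h.2) Qv⁻¹ = X2 at n3 ⊢
    generalize (1 - t) / (1 - q) * (psi lam c / psiStar (addCell lam c h.2) c) = B
    field_simp
  · intro c h
    have key := nekT_ratio mu lam c h Qv⁻¹ hQi
    rw [inv_inv] at key
    unfold blm
    rw [bcoef_add mu c h]
    have n1 := nekT_ne lam mu _ hQ
    have n2 := nekT_ne mu lam _ hQi
    have n3 := nekT_ne lam (addCell mu c h.2) _ hQ
    have n4 := nekT_ne (addCell mu c h.2) lam _ hQi
    have hx : chi c / Qv = Qv⁻¹ * chi c := by ring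
    rw [hx]
    have hP : PsiF lam (Qv⁻¹ * chi c) ≠ 0 := by
      intro h0
      rw [h0, mul_zero] at key
      exact mul_ne_zero n4 n1 key
    have key2 : nekT (addCell mu c h.2) lam Qv⁻¹ = nekT mu lam Qv⁻¹ *
        nekT lam (addCell mu c h.2) Qv * PsiF lam (Qv⁻¹ * chi c) / nekT lam mu Qv := by
      rw [← key, mul_div_cancel_right₀ _ n1]
    rw [key2]
    generalize nekT mu lam Qv⁻¹ = X1 at n2 ⊢
    generalize PsiF lam (Qv⁻¹ * chi c) = X2 at hP ⊢
    generalize (1 - t) / (1 - q) * (psi mu c / psiStar (addCell mu c h.2) c) = B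
    field_simp

end
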